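/- Varopoulos–Carne bound: for a reversible Markov chain with reversible measure π on a countable state space, the n-step transition probability satisfies P^n(a,b) ≤ 2·sqrt(π(b)/π(a))·exp(−d(a,b)²/(2n)), where d(a,b) is the graph distance in the transition graph. -/

import Mathlib

/-- `n`-step transition probabilities of the kernel `P` on a countable state space. -/
noncomputable def npow {V : Type*} [DecidableEq V] (P : V → V → ℝ) : ℕ → V → V → ℝ
  | 0 => fun a b => if a = b then (1 : ℝ) else 0
  | (n + 1) => fun a b => ∑' c, npow P n a c * P c b

/-- Graph distance in the transition graph of `P` (edge between `a` and `b` iff `P a b > 0`). -/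
noncomputable def graphDist {V : Type*} (P : V → V → ℝ) (a b : V) : ℕ :=
  sInf {n : ℕ | ∃ f : ℕ → V, f 0 = a ∧ f n = b ∧ ∀ i < n, 0 < P (f i) (f (i + 1))}

open Polynomial in
theorem vc_pell (n : ℕ) : (Chebyshev.T ℝ (n : ℤ)) ^ 2
    + (1 - X ^ 2) * (Chebyshev.U ℝ ((n : ℤ) - 1)) ^ 2 = 1 := by
  induction n with
  | zero => simp
  | succ n ih =>
    have h1 := Chebyshev.T_eq_X_mul_T_sub_pol_U ℝ ((n : ℤ) - 1)
    have h2 := Chebyshev.U_eq_X_mul_U_add_T ℝ ((n : ℤ) - 1)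
    have e1 : (n : ℤ) - 1 + 2 = n + 1 := by ring
    have e2 : (n : ℤ) - 1 + 1 = n := by ring
    rw [e1, e2] at h1
    rw [e2] at h2
    push_cast
    rw [add_sub_cancel_right, h1, h2]
    linear_combination ih

open Polynomial in
theorem vc_pell' (m : ℤ) : ∃ W : ℝ[X], (Chebyshev.T ℝ m) ^ 2 + (1 - X ^ 2) * W ^ 2 = 1 := by
  rw [← Chebyshev.T_natAbs]
  exact ⟨_, vc_pell _⟩

open Polynomial Matrix in
theorem vc_symm {ι : Type*} [Fintype ι] [DecidableEq ι] (M : Matrix ι ι ℝ) (hM : Mᵀ = M)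
    (p : ℝ[X]) : (aeval M p)ᵀ = aeval M p := by
  induction p using Polynomial.induction_on' with
  | add p q hp hq => simp [hp, hq]
  | monomial n a => 
    rw [aeval_monomial, transpose_mul, transpose_pow, hM]
    have : ((algebraMap ℝ (Matrix ι ι ℝ)) a)ᵀ = algebraMap ℝ (Matrix ι ι ℝ) a := by
      simp [Matrix.algebraMap_eq_diagonal]
    rw [this, Algebra.commutes]

open Polynomial Matrix in
theorem vc_T_le {ι : Type*} [Fintype ι] [DecidableEq ι] (M : Matrix ι ι ℝ) (hM : Mᵀ = M)
    (hc : ∀ v : ι → ℝ, ∑ i, (∑ j, M i j * v j) ^ 2 ≤ ∑ j, v j ^ 2) (m : ℤ) (a b : ι) :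
    |aeval M (Chebyshev.T ℝ m) a b| ≤ 1 := by
  obtain ⟨W, hW⟩ := vc_pell' m
  set N := aeval M (Chebyshev.T ℝ m) with hN
  set Y := aeval M W with hY
  have hNs : Nᵀ = N := vc_symm M hM _
  have hYs : Yᵀ = Y := vc_symm M hM _
  have h1 : Nᵀ * N + Yᵀ * Y = 1 + (M * Y)ᵀ * (M * Y) := by
    have h := congrArg (aeval M) hW
    simp only [map_add, map_mul, map_sub, map_pow, map_one, aeval_X, ← hN, ← hY] at h
    have hcomm : M * Y = Y * M := by
      have := congrArg (aeval M) (mul_comm X W)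
      simpa using this
    rw [transpose_mul, hNs, hYs, hM, ← h]
    have : Y * M * (M * Y) = M * M * (Y * Y) := by
      rw [← hcomm]; rw [mul_assoc, mul_assoc, ← mul_assoc Y M Y, ← hcomm, mul_assoc]
    rw [this]
    noncomm_ring
  have h2 := congrFun (congrFun h1 b) b
  simp only [Matrix.add_apply, Matrix.mul_apply, Matrix.transpose_apply, Matrix.one_apply_eq] at h2
  have h3 := hc (fun j => Y j b)
  simp only [sq] at h3
  have h4 : N a b * N a b ≤ ∑ i, N i b * N i b :=
    Finset.single_le_sum (f := fun i => N i b * N i b) (fun i _ => mul_self_nonneg _) (Finset.mem_univ a)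
  rw [abs_le_one_iff_mul_self_le_one]
  linarith

open Polynomial Matrix in
theorem vc_main {ι : Type*} [Fintype ι] [DecidableEq ι] (M : Matrix ι ι ℝ) (hM : Mᵀ = M)
    (hc : ∀ v : ι → ℝ, ∑ i, (∑ j, M i j * v j) ^ 2 ≤ ∑ j, v j ^ 2) (a b : ι) (d : ℕ)
    (hd : ∀ k < d, (M ^ k) a b = 0) (s : ℝ) (hs : 0 ≤ s) (n : ℕ) : ∀ m : ℤ,
    |(M ^ n * aeval M (Chebyshev.T ℝ m)) a b| ≤
      Real.cosh s ^ n * (Real.exp (s * (m - d)) + Real.exp (s * (-m - d))) := by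
  induction n with
  | zero =>
    intro m
    rw [pow_zero, one_mul, pow_zero, one_mul]
    by_cases h : m.natAbs < d
    · have : aeval M (Chebyshev.T ℝ m) a b = 0 := by
        rw [aeval_eq_sum_range' (n := d) (by rwa [Chebyshev.natDegree_T]), Matrix.sum_apply]
        apply Finset.sum_eq_zero
        intro i hi
        rw [Matrix.smul_apply, hd i (Finset.mem_range.1 hi), smul_zero]
      rw [this, abs_zero]
      positivity
    · refine (vc_T_le M hM hc m a b).trans ?_
      have : (d : ℤ) ≤ m ∨ (d : ℤ) ≤ -m := by omega
      rcases this with h | h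
      · have h' : (d : ℝ) ≤ m := by exact_mod_cast h
        have := Real.one_le_exp (mul_nonneg hs (sub_nonneg.2 h'))
        have := Real.exp_pos (s * (-m - d))
        linarith
      · have h' : (d : ℝ) ≤ -m := by exact_mod_cast h
        have := Real.one_le_exp (mul_nonneg hs (sub_nonneg.2 h'))
        have := Real.exp_pos (s * (m - d))
        linarith
  | succ n ih =>
    intro m
    have key : (2 : ℝ) • (M ^ (n + 1) * aeval M (Chebyshev.T ℝ m)) =
        M ^ n * aeval M (Chebyshev.T ℝ (m + 1)) + M ^ n * aeval M (Chebyshev.T ℝ (m - 1)) := by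
      rw [Chebyshev.T_add_one]
      simp only [map_sub, map_mul, aeval_X, map_ofNat]
      rw [pow_succ, two_smul]
      noncomm_ring
    have k2 := congrFun (congrFun key a) b
    rw [Matrix.smul_apply, Matrix.add_apply, smul_eq_mul] at k2
    have i1 := ih (m + 1)
    have i2 := ih (m - 1)
    have e : 2 * (Real.cosh s ^ (n+1) * (Real.exp (s * (m - d)) + Real.exp (s * (-m - d)))) =
      Real.cosh s ^ n * (Real.exp (s * ((m + 1 : ℤ) - d)) + Real.exp (s * (-(m + 1 : ℤ) - d))) +
      Real.cosh s ^ n * (Real.exp (s * ((m - 1 : ℤ) - d)) + Real.exp (s * (-(m - 1 : ℤ) - d))) := by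
      have a1 : s * (((m + 1 : ℤ) : ℝ) - d) = s * (m - d) + s := by push_cast; ring
      have a2 : s * (-((m + 1 : ℤ) : ℝ) - d) = s * (-m - d) + -s := by push_cast; ring
      have a3 : s * (((m - 1 : ℤ) : ℝ) - d) = s * (m - d) + -s := by push_cast; ring
      have a4 : s * (-((m - 1 : ℤ) : ℝ) - d) = s * (-m - d) + s := by push_cast; ring
      rw [a1, a2, a3, a4, pow_succ, Real.cosh_eq]
      simp only [Real.exp_add]
      ring
    rw [abs_le] at i1 i2 ⊢
    constructor <;> linarith

theorem vc_fin {ι : Type*} [Fintype ι] [DecidableEq ι] (M : Matrix ι ι ℝ) (hM : M.transpose = M)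
    (hc : ∀ v : ι → ℝ, ∑ i, (∑ j, M i j * v j) ^ 2 ≤ ∑ j, v j ^ 2) (a b : ι) (d : ℕ)
    (hd : ∀ k < d, (M ^ k) a b = 0) (n : ℕ) (hn : 0 < n) :
    (M ^ n) a b ≤ 2 * Real.exp (-(d : ℝ) ^ 2 / (2 * n)) := by
  have hn' : (0 : ℝ) < n := by exact_mod_cast hn
  have h := vc_main M hM hc a b d hd (d / n) (by positivity) n 0
  simp only [Polynomial.Chebyshev.T_zero, map_one, mul_one, Int.cast_zero, neg_zero] at h
  refine (le_abs_self _).trans (h.trans ?_)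
  have h2 : Real.cosh (d / n) ^ n ≤ Real.exp ((d / n : ℝ) ^ 2 / 2) ^ n :=
    pow_le_pow_left₀ (Real.cosh_pos _).le (Real.cosh_le_exp_half_sq _) n
  rw [← Real.exp_nat_mul] at h2
  calc _ ≤ Real.exp (n * ((d / n : ℝ) ^ 2 / 2)) * (Real.exp (d / n * (0 - d)) + Real.exp (d / n * (0 - d))) := by
        gcongr
    _ = 2 * (Real.exp (n * ((d / n : ℝ) ^ 2 / 2)) * Real.exp (d / n * (0 - d))) := by ring
    _ = _ := by
        rw [← Real.exp_add]
        congr 2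
        field_simp
        ring

/-- Transition probabilities through a finite set. -/
noncomputable def vcQ {V : Type*} [DecidableEq V] (P : V → V → ℝ) (F : Finset V) : ℕ → V → V → ℝ
  | 0 => fun a b => if a = b then (1 : ℝ) else 0
  | (n + 1) => fun a b => ∑ c ∈ F, vcQ P F n a c * P c b

theorem vcQ_nonneg {V : Type*} [DecidableEq V] (P : V → V → ℝ) (hnonneg : ∀ a b, 0 ≤ P a b)
    (F : Finset V) (n : ℕ) (a b : V) : 0 ≤ vcQ P F n a b := by
  induction n generalizing b with
  | zero => simp only [vcQ]; split_ifs <;> norm_num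
  | succ n ih => exact Finset.sum_nonneg fun c _ => mul_nonneg (ih c) (hnonneg _ _)

theorem vcQ_path {V : Type*} [DecidableEq V] (P : V → V → ℝ) (hnonneg : ∀ a b, 0 ≤ P a b)
    (F : Finset V) (n : ℕ) (a b : V) (h : vcQ P F n a b ≠ 0) :
    ∃ f : ℕ → V, f 0 = a ∧ f n = b ∧ ∀ i < n, 0 < P (f i) (f (i + 1)) := by
  induction n generalizing b with
  | zero =>
    have : a = b := by
      by_contra hab
      exact h (by simp [vcQ, hab])
    exact ⟨fun _ => a, rfl, this, by simp⟩
  | succ n ih =>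
    obtain ⟨c, _, hc⟩ := Finset.exists_ne_zero_of_sum_ne_zero h
    obtain ⟨f, h0, h1, h2⟩ := ih c (left_ne_zero_of_mul hc)
    refine ⟨fun i => if i ≤ n then f i else b, by simp [h0], by simp, ?_⟩
    intro i hi
    rcases Nat.lt_succ_iff_lt_or_eq.1 hi with h | h
    · have h3 : i ≤ n := h.le
      have h4 : i + 1 ≤ n := h
      simp only [h3, h4, if_true]
      exact h2 i h
    · subst h
      simp only [le_refl, if_true, Nat.not_succ_le_self, if_false, h1]
      exact lt_of_le_of_ne (hnonneg _ _) (right_ne_zero_of_mul hc).symm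

theorem vcQ_zero {V : Type*} [DecidableEq V] (P : V → V → ℝ) (hnonneg : ∀ a b, 0 ≤ P a b)
    (F : Finset V) (n : ℕ) (a b : V) (h : n < graphDist P a b) : vcQ P F n a b = 0 := by
  by_contra hne
  exact absurd (Nat.sInf_le (vcQ_path P hnonneg F n a b hne)) (not_le.2 h)

theorem vc_summable {V : Type*} (P : V → V → ℝ) (hrow : ∀ a, ∑' b, P a b = 1) (a : V) :
    Summable (P a) := by
  by_contra h
  have := hrow a
  rw [tsum_eq_zero_of_not_summable h] at this
  norm_num at this

section
variable {V : Type*} [DecidableEq V]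
    (P : V → V → ℝ) (hnonneg : ∀ a b, 0 ≤ P a b) (hrow : ∀ a, ∑' b, P a b = 1)
    (pi : V → ℝ) (hpos : ∀ a, 0 < pi a)
    (hrev : ∀ a b, pi a * P a b = pi b * P b a)
include hnonneg hrow hpos hrev

theorem vc_npow_bound (n : ℕ) (a b : V) : 0 ≤ npow P n a b ∧ npow P n a b ≤ pi b / pi a ∧
    Summable (fun c => npow P n a c * P c b) := by
  have key : (∀ c, 0 ≤ npow P n a c ∧ npow P n a c ≤ pi c / pi a) → ∀ b,
      (∀ c, npow P n a c * P c b ≤ pi b / pi a * P b c) ∧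
      Summable (fun c => npow P n a c * P c b) := by
    intro h b
    have h1 : ∀ c, npow P n a c * P c b ≤ pi b / pi a * P b c := by
      intro c
      calc _ ≤ pi c / pi a * P c b := mul_le_mul_of_nonneg_right (h c).2 (hnonneg _ _)
        _ = _ := by rw [div_mul_eq_mul_div, hrev, div_mul_eq_mul_div]
    exact ⟨h1, Summable.of_nonneg_of_le (fun c => mul_nonneg (h c).1 (hnonneg _ _)) h1
      ((vc_summable P hrow b).mul_left _)⟩
  have main : ∀ c, 0 ≤ npow P n a c ∧ npow P n a c ≤ pi c / pi a := by
    clear b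
    induction n with
    | zero =>
      intro c
      simp only [npow]
      split_ifs with h
      · subst h
        rw [div_self (hpos _).ne']
        norm_num
      · exact ⟨le_rfl, (div_pos (hpos _) (hpos _)).le⟩
    | succ n ih =>
      have ih' := ih ?_
      · intro b
        have k : (∀ c, npow P n a c * P c b ≤ pi b / pi a * P b c) := by
          intro c
          calc _ ≤ pi c / pi a * P c b := mul_le_mul_of_nonneg_right (ih' c).2 (hnonneg _ _)
            _ = _ := by rw [div_mul_eq_mul_div, hrev, div_mul_eq_mul_div]
        have hs := (vc_summable P hrow b).mul_left (pi b / pi a)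
        have k2 : Summable (fun c => npow P n a c * P c b) :=
          Summable.of_nonneg_of_le (fun c => mul_nonneg (ih' c).1 (hnonneg _ _)) k hs
        refine ⟨tsum_nonneg fun c => mul_nonneg (ih' c).1 (hnonneg _ _), ?_⟩
        have := k2.tsum_le_tsum k hs
        rw [tsum_mul_left, hrow, mul_one] at this
        exact this
      · intro h b
        have h1 : ∀ c, npow P n a c * P c b ≤ pi b / pi a * P b c := by
          intro c
          calc _ ≤ pi c / pi a * P c b := mul_le_mul_of_nonneg_right (h c).2 (hnonneg _ _)
            _ = _ := by rw [div_mul_eq_mul_div, hrev, div_mul_eq_mul_div]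
        exact ⟨h1, Summable.of_nonneg_of_le (fun c => mul_nonneg (h c).1 (hnonneg _ _)) h1
          ((vc_summable P hrow b).mul_left _)⟩
  exact ⟨(main b).1, (main b).2, (key main b).2⟩

theorem vcQ_le (F : Finset V) (n : ℕ) (a b : V) : vcQ P F n a b ≤ npow P n a b := by
  induction n generalizing b with
  | zero => exact le_rfl
  | succ n ih =>
    have hb := vc_npow_bound P hnonneg hrow pi hpos hrev n a
    calc vcQ P F (n+1) a b ≤ ∑ c ∈ F, npow P n a c * P c b :=
          Finset.sum_le_sum fun c _ => mul_le_mul_of_nonneg_right (ih c) (hnonneg _ _)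
      _ ≤ _ := (hb b).2.2.sum_le_tsum F fun c _ => mul_nonneg (hb c).1 (hnonneg _ _)

theorem vcQ_tendsto (n : ℕ) (a b : V) :
    Filter.Tendsto (fun F : Finset V => vcQ P F n a b) Filter.atTop (nhds (npow P n a b)) := by
  induction n generalizing b with
  | zero => exact tendsto_const_nhds
  | succ n ih =>
    have hb := vc_npow_bound P hnonneg hrow pi hpos hrev n a
    have e : (fun F : Finset V => vcQ P F (n+1) a b) =
        fun F => ∑' c, if c ∈ F then vcQ P F n a c * P c b else 0 := by
      funext F
      rw [tsum_eq_sum (s := F) (fun c hc => by simp [hc])]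
      exact Finset.sum_congr rfl fun c hc => by simp [hc]
    rw [e]
    refine tendsto_tsum_of_dominated_convergence (hb b).2.2 ?_ ?_
    · intro c
      refine ((ih c).mul_const (P c b)).congr' ?_
      filter_upwards [Filter.eventually_ge_atTop {c}] with F hF
      rw [if_pos (hF (Finset.mem_singleton_self c))]
    · refine Filter.Eventually.of_forall fun F c => ?_
      split_ifs
      · rw [Real.norm_of_nonneg (mul_nonneg (vcQ_nonneg P hnonneg F n a c) (hnonneg _ _))]
        exact mul_le_mul_of_nonneg_right (vcQ_le P hnonneg hrow pi hpos hrev F n a c) (hnonneg _ _)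
      · rw [norm_zero]
        exact mul_nonneg (hb c).1 (hnonneg _ _)

theorem vcQ_bound (F : Finset V) (n : ℕ) (hn : 0 < n) (a b : V) (ha : a ∈ F) (hb : b ∈ F) :
    vcQ P F n a b ≤ 2 * Real.sqrt (pi b / pi a) *
      Real.exp (-(graphDist P a b : ℝ) ^ 2 / (2 * n)) := by
  have sp : ∀ c, 0 < Real.sqrt (pi c) := fun c => Real.sqrt_pos.2 (hpos c)
  have ss : ∀ c, Real.sqrt (pi c) * Real.sqrt (pi c) = pi c := fun c => Real.mul_self_sqrt (hpos c).le
  have hsum : ∀ c : V, ∑ j : F, P c j ≤ 1 := by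
    intro c
    rw [Finset.sum_coe_sort F (P c), ← hrow c]
    exact (vc_summable P hrow c).sum_le_tsum F fun _ _ => hnonneg _ _
  let M : Matrix F F ℝ := fun i j => Real.sqrt (pi i) * P i j / Real.sqrt (pi j)
  have hM : M.transpose = M := by
    ext i j
    change Real.sqrt (pi j) * P j i / Real.sqrt (pi i) = Real.sqrt (pi i) * P i j / Real.sqrt (pi j)
    rw [div_eq_div_iff (sp i).ne' (sp j).ne']
    have := hrev i j
    rw [← ss i, ← ss j] at this
    linarith
  have hc : ∀ v : F → ℝ, ∑ i, (∑ j, M i j * v j) ^ 2 ≤ ∑ j, v j ^ 2 := by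
    intro v
    have h1 : ∀ i : F, (∑ j, M i j * v j) ^ 2 ≤ ∑ j : F, P j i * v j ^ 2 := by
      intro i
      have := Finset.sum_sq_le_sum_mul_sum_of_sq_le_mul Finset.univ (r := fun j => M i j * v j)
        (f := fun j : F => P i j) (g := fun j : F => P j i * v j ^ 2)
        (fun j _ => hnonneg _ _) (fun j _ => mul_nonneg (hnonneg _ _) (sq_nonneg _)) (by
          intro j _
          apply le_of_eq
          have : M i j * M i j = P i j * P j i := by
            have h2 : M i j * M i j = M i j * M j i := by
              congr 1
              exact congrFun (congrFun hM j) i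
            rw [h2]
            change Real.sqrt (pi i) * P i j / Real.sqrt (pi j) *
              (Real.sqrt (pi j) * P j i / Real.sqrt (pi i)) = _
            have := (sp i).ne'
            have := (sp j).ne'
            field_simp
          rw [mul_pow, sq (M i j), this, mul_assoc])
      refine this.trans ?_
      exact mul_le_of_le_one_left
        (Finset.sum_nonneg fun j _ => mul_nonneg (hnonneg _ _) (sq_nonneg _)) (hsum i)
    refine (Finset.sum_le_sum fun i _ => h1 i).trans ?_
    rw [Finset.sum_comm]
    refine Finset.sum_le_sum fun j _ => ?_
    rw [← Finset.sum_mul]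
    exact mul_le_of_le_one_left (sq_nonneg _) (hsum j)
  have hpow : ∀ (k : ℕ) (i j : F), (M ^ k) i j =
      Real.sqrt (pi i) * vcQ P F k i j / Real.sqrt (pi j) := by
    intro k
    induction k with
    | zero =>
      intro i j
      simp only [pow_zero, Matrix.one_apply, vcQ]
      by_cases h : i = j
      · subst h
        simp [(sp i).ne']
      · have h' : (i : V) ≠ j := fun e => h (Subtype.ext e)
        simp [h, h']
    | succ k ih =>
      intro i j
      rw [pow_succ, Matrix.mul_apply]
      simp only [vcQ]
      rw [← Finset.sum_coe_sort F (fun c => vcQ P F k i c * P c j), Finset.mul_sum, Finset.sum_div]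
      refine Finset.sum_congr rfl fun c _ => ?_
      rw [ih]
      change _ * (Real.sqrt (pi c) * P c j / Real.sqrt (pi j)) = _
      have := (sp c).ne'
      field_simp
  have := vc_fin M hM hc ⟨a, ha⟩ ⟨b, hb⟩ (graphDist P a b) (by
    intro k hk
    rw [hpow, vcQ_zero P hnonneg F k a b hk]
    simp) n hn
  rw [hpow, div_le_iff₀ (sp _)] at this
  rw [Real.sqrt_div (hpos b).le, mul_div_assoc', div_mul_eq_mul_div, le_div_iff₀ (sp _)]
  simp only at this
  linarith

end

/-- Varopoulos–Carne bound: for a reversible Markov chain with reversible measure `π`,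
`P^n(a,b) ≤ 2 √(π(b)/π(a)) exp(−d(a,b)²/(2n))`. -/
theorem stmt3 {V : Type*} [Countable V] [DecidableEq V]
    (P : V → V → ℝ) (hnonneg : ∀ a b, 0 ≤ P a b) (hrow : ∀ a, ∑' b, P a b = 1)
    (pi : V → ℝ) (hpos : ∀ a, 0 < pi a)
    (hrev : ∀ a b, pi a * P a b = pi b * P b a)
    (a b : V) (n : ℕ) (hn : 0 < n) :
    npow P n a b ≤ 2 * Real.sqrt (pi b / pi a) *
      Real.exp (-(graphDist P a b : ℝ) ^ 2 / (2 * n)) := by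
  refine le_of_tendsto (vcQ_tendsto P hnonneg hrow pi hpos hrev n a b) ?_
  filter_upwards [Filter.eventually_ge_atTop {a, b}] with F hF
  exact vcQ_bound P hnonneg hrow pi hpos hrev F n hn a b (hF (by simp)) (hF (by simp))
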